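/- For any distribution D on X × {-1,1}, any set H of voters f : X → [-1,1], any prior distribution P on H, any δ ∈ (0,1], and with α_Q^{D'} denoting any one of the expected disagreement d_Q^{D'}, the expected joint error e_Q^{D'}, or the expected joint success s_Q^{D'}: with probability at least 1 − δ over the draw of S ∼ D^m, simultaneously for all posterior distributions Q on H, kl(α_Q^S ‖ α_Q^D) ≤ (1/m)·[2·KL(Q‖P) + ln(ξ(m)/δ)]. -/

import Mathlib

open MeasureTheory

open Classical in
/-- Kullback–Leibler divergence `KL(Q‖P) = E_{f∼Q} ln (dQ/dP)(f)`, with value `⊤`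
when `Q` is not absolutely continuous w.r.t. `P` or the divergence is not finite. -/
noncomputable def klDivE {ι : Type*} [MeasurableSpace ι] (Q P : Measure ι) : EReal :=
  if Q ≪ P ∧ Integrable (fun i => Real.log ((Q.rnDeriv P) i).toReal) Q
  then ((∫ i, Real.log ((Q.rnDeriv P) i).toReal ∂Q : ℝ) : EReal)
  else ⊤

/-- `kl(q‖p)`: the KL divergence between Bernoulli distributions of parameters `q`, `p`. -/
noncomputable def klBin (q p : ℝ) : ℝ :=
  q * Real.log (q / p) + (1 - q) * Real.log ((1 - q) / (1 - p))

/-- `ξ(m) = Σ_{k=0}^m C(m,k)·(k/m)^k·(1 - k/m)^{m-k}` (with `0⁰ = 1`). -/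
noncomputable def xi (m : ℕ) : ℝ :=
  ∑ k ∈ Finset.range (m + 1),
    (m.choose k : ℝ) * ((k : ℝ) / (m : ℝ)) ^ k * (1 - (k : ℝ) / (m : ℝ)) ^ (m - k)

/-- Paired loss giving the expected disagreement `d`. -/
noncomputable def pairedLossD : ℝ → ℝ → ℝ → ℝ := fun a b _ => (1 - a * b) / 2

/-- Paired loss giving the expected joint error `e`. -/
noncomputable def pairedLossE : ℝ → ℝ → ℝ → ℝ :=
  fun a b y => ((1 - y * a) / 2) * ((1 - y * b) / 2)

/-- Paired loss giving the expected joint success `s`. -/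
noncomputable def pairedLossS : ℝ → ℝ → ℝ → ℝ :=
  fun a b y => ((1 + y * a) / 2) * ((1 + y * b) / 2)

section BernoulliDivergence

lemma tangent_le_mul_log_div {q p r : ℝ} (hq : 0 ≤ q) (hp : 0 ≤ p) (hr : 0 < r)
    (hqp : p = 0 → q = 0) : q * Real.log r + q - p * r ≤ q * Real.log (q / p) := by
  rcases hq.eq_or_lt with rfl | hq
  · simpa using mul_nonneg hp hr.le
  have hp : 0 < p := hp.lt_of_ne fun h => hq.ne' (hqp h.symm)
  have h := Real.log_le_sub_one_of_pos (show 0 < p * r / q by positivity)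
  rw [Real.log_div (by positivity) hq.ne', Real.log_mul hp.ne' hr.ne'] at h
  rw [Real.log_div hq.ne' hp.ne']
  have h' := mul_le_mul_of_nonneg_left h hq.le
  have : q * (p * r / q - 1) = p * r - q := by field_simp
  linarith

lemma exists_mul_log_div_le_tangent {q p ε : ℝ} (hq : 0 ≤ q) (hp : 0 ≤ p) (hε : 0 < ε) :
    ∃ r, 0 < r ∧ q * Real.log (q / p) ≤ q * Real.log r + q - p * r + ε := by
  rcases hp.eq_or_lt with rfl | hp
  · exact ⟨1, one_pos, by simp; positivity⟩
  rcases hq.eq_or_lt with rfl | hq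
  · refine ⟨ε / p, by positivity, le_of_eq ?_⟩
    field_simp
    simp
  · refine ⟨q / p, by positivity, ?_⟩
    rw [mul_div_cancel₀ _ hp.ne']
    linarith

/-- The affine minorant of `klBin` with slopes `log r` and `log s`. -/
noncomputable def klTangent (r s q p : ℝ) : ℝ :=
  (q * Real.log r + q - p * r) + ((1 - q) * Real.log s + (1 - q) - (1 - p) * s)

lemma klTangent_le_klBin {r s q p : ℝ} (hr : 0 < r) (hs : 0 < s) (hq : q ∈ Set.Icc (0 : ℝ) 1)
    (hp : p ∈ Set.Icc (0 : ℝ) 1) (h₀ : p = 0 → q = 0) (h₁ : p = 1 → q = 1) :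
    klTangent r s q p ≤ klBin q p :=
  add_le_add (tangent_le_mul_log_div hq.1 hp.1 hr h₀)
    (tangent_le_mul_log_div (sub_nonneg.2 hq.2) (sub_nonneg.2 hp.2) hs
      fun h => by rw [h₁ (by linarith), sub_self])

lemma klBin_le_of_forall_klTangent_le {q p B : ℝ} (hq : q ∈ Set.Icc (0 : ℝ) 1)
    (hp : p ∈ Set.Icc (0 : ℝ) 1) (h : ∀ r s, 0 < r → 0 < s → klTangent r s q p ≤ B) :
    klBin q p ≤ B := by
  refine le_of_forall_pos_le_add fun ε hε => ?_
  obtain ⟨r, hr, h₁⟩ := exists_mul_log_div_le_tangent hq.1 hp.1 (half_pos hε)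
  obtain ⟨s, hs, h₂⟩ := exists_mul_log_div_le_tangent (sub_nonneg.2 hq.2)
    (sub_nonneg.2 hp.2) (half_pos hε)
  have h₃ := h r s hr hs
  unfold klTangent at h₃
  unfold klBin
  linarith

lemma convexOn_klBin {p : ℝ} (hp : p ∈ Set.Ioo (0 : ℝ) 1) :
    ConvexOn ℝ (Set.Icc 0 1) fun q => klBin q p := by
  have hp' : 0 < 1 - p := sub_pos.2 hp.2
  have key : ∀ q ∈ Set.Icc (0 : ℝ) 1, -Real.binEntropy q
      + (q * (Real.log (1 - p) - Real.log p) - Real.log (1 - p)) = klBin q p := by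
    intro q _
    have aux : ∀ a b : ℝ, 0 < b → a * Real.log (a / b) = a * Real.log a - a * Real.log b := by
      intro a b hb
      rcases eq_or_ne a 0 with rfl | ha
      · simp
      · rw [Real.log_div ha hb.ne', mul_sub]
    rw [klBin, aux q p hp.1, aux _ _ hp', Real.binEntropy, Real.log_inv, Real.log_inv]
    ring
  refine ConvexOn.congr (f := fun q => -Real.binEntropy q
      + (q * (Real.log (1 - p) - Real.log p) - Real.log (1 - p))) ?_ key
  refine Real.strictConcave_binEntropy.concaveOn.neg.add ⟨convex_Icc 0 1, ?_⟩
  intro x _ y _ a b _ _ hab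
  refine le_of_eq ?_
  simp only [smul_eq_mul]
  linear_combination Real.log (1 - p) * hab

lemma exp_mul_klBin_div {m k : ℕ} (hk : k ≤ m) {p : ℝ} (hp : p ∈ Set.Ioo (0 : ℝ) 1) :
    p ^ k * (1 - p) ^ (m - k) * Real.exp (m * klBin (k / m) p)
      = (k / m : ℝ) ^ k * (1 - k / m : ℝ) ^ (m - k) := by
  have hp' : 0 < 1 - p := sub_pos.2 hp.2
  rcases Nat.eq_zero_or_pos m with rfl | hm
  · simp [Nat.le_zero.1 hk]
  have hm' : (0 : ℝ) < m := by exact_mod_cast hm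
  have aux : ∀ (n : ℕ) (b : ℝ), 0 < b →
      b ^ n * Real.exp (n * Real.log (n / m / b)) = (n / m : ℝ) ^ n := by
    intro n b hb
    rcases Nat.eq_zero_or_pos n with rfl | hn
    · simp
    have hn' : (0 : ℝ) < n := by exact_mod_cast hn
    rw [Real.exp_nat_mul, Real.exp_log (by positivity), ← mul_pow, mul_div_cancel₀ _ hb.ne']
  have h1 : (1 - k / m : ℝ) = ((m - k : ℕ) : ℝ) / m := by
    rw [Nat.cast_sub hk]; field_simp
  have h2 : (m : ℝ) * klBin (k / m) p = k * Real.log (k / m / p)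
      + ((m - k : ℕ) : ℝ) * Real.log (((m - k : ℕ) : ℝ) / m / (1 - p)) := by
    rw [klBin, h1]; field_simp
  rw [h2, h1, Real.exp_add, ← aux k p hp.1, ← aux (m - k) (1 - p) hp']
  ring

lemma one_le_xi (m : ℕ) : 1 ≤ xi m := by
  have h : ∀ k ∈ Finset.range (m + 1), 0 ≤
      (m.choose k : ℝ) * ((k : ℝ) / (m : ℝ)) ^ k * (1 - (k : ℝ) / (m : ℝ)) ^ (m - k) := by
    intro k hk
    have : (k : ℝ) / m ≤ 1 :=
      div_le_one_of_le₀ (by exact_mod_cast Finset.mem_range_succ_iff.1 hk) (by positivity)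
    have := sub_nonneg.2 this
    positivity
  simpa [xi] using Finset.single_le_sum h (Finset.mem_range.2 m.succ_pos)

end BernoulliDivergence

section MultilinearInterpolation

variable {κ : Type*} [Fintype κ] [DecidableEq κ]

/-- The probability of the subset `T` when each `k` is selected independently with
probability `x k`. -/
def subsetWeight (x : κ → ℝ) (T : Finset κ) : ℝ := ∏ k, if k ∈ T then x k else 1 - x k

lemma sum_prod_ite_mem (f g : κ → ℝ) :
    ∑ T : Finset κ, ∏ k, (if k ∈ T then f k else g k) = ∏ k, (f k + g k) := by
  rw [Finset.prod_add, Finset.powerset_univ]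
  refine Finset.sum_congr rfl fun T _ => ?_
  rw [Finset.prod_ite]
  congr 2 <;> ext k <;> simp

lemma subsetWeight_nonneg {x : κ → ℝ} (hx : ∀ k, x k ∈ Set.Icc (0 : ℝ) 1) (T : Finset κ) :
    0 ≤ subsetWeight x T :=
  Finset.prod_nonneg fun k _ => by
    split_ifs
    exacts [(hx k).1, sub_nonneg.2 (hx k).2]

lemma sum_subsetWeight (x : κ → ℝ) : ∑ T, subsetWeight x T = 1 := by
  simp [subsetWeight, sum_prod_ite_mem]

lemma sum_subsetWeight_mul_card (x : κ → ℝ) :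
    ∑ T, subsetWeight x T * (T.card : ℝ) = ∑ k, x k := by
  have h : ∀ k, ∑ T, subsetWeight x T * (if k ∈ T then 1 else 0) = x k := by
    intro k
    calc ∑ T, subsetWeight x T * (if k ∈ T then 1 else 0)
        = ∑ T : Finset κ, ∏ j, (if j ∈ T then x j else if j = k then 0 else 1 - x j) := by
          refine Finset.sum_congr rfl fun T _ => ?_
          by_cases hk : k ∈ T
          · simp only [subsetWeight, hk, if_true, mul_one]
            refine Finset.prod_congr rfl fun j _ => ?_
            by_cases hj : j = k
            · subst hj; simp [hk]
            · simp [hj]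
          · rw [if_neg hk, mul_zero]
            exact (Finset.prod_eq_zero (Finset.mem_univ k) (by simp [hk])).symm
      _ = x k := by
          rw [sum_prod_ite_mem, Finset.prod_eq_single k]
          · simp
          · intro j _ hj; simp [hj]
          · simp
  calc ∑ T, subsetWeight x T * (T.card : ℝ)
      = ∑ T, ∑ k, subsetWeight x T * (if k ∈ T then 1 else 0) := by
        refine Finset.sum_congr rfl fun T _ => ?_
        rw [← Finset.mul_sum]; simp
    _ = ∑ k, x k := by rw [Finset.sum_comm]; exact Finset.sum_congr rfl fun k _ => h k

lemma exp_mul_klBin_mean_le {m : ℕ} (hm : 0 < m) {p : ℝ} (hp : p ∈ Set.Ioo (0 : ℝ) 1)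
    {x : Fin m → ℝ} (hx : ∀ k, x k ∈ Set.Icc (0 : ℝ) 1) :
    Real.exp (m * klBin ((m : ℝ)⁻¹ * ∑ k, x k) p)
      ≤ ∑ T, subsetWeight x T * Real.exp (m * klBin ((T.card : ℝ) / m) p) := by
  have hm' : (0 : ℝ) < m := by exact_mod_cast hm
  have hmem : ∀ T ∈ (Finset.univ : Finset (Finset (Fin m))),
      (T.card : ℝ) / m ∈ Set.Icc (0 : ℝ) 1 := fun T _ =>
    ⟨by positivity, div_le_one_of_le₀ (by exact_mod_cast card_finset_fin_le T) hm'.le⟩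
  have h₁ := (convexOn_klBin hp).map_sum_le (fun T _ => subsetWeight_nonneg hx T)
    (sum_subsetWeight x) hmem
  have h₂ := convexOn_exp.map_sum_le (p := fun T : Finset (Fin m) => m * klBin ((T.card : ℝ) / m) p)
    (fun T _ => subsetWeight_nonneg hx T) (sum_subsetWeight x) (fun _ _ => Set.mem_univ _)
  simp only [smul_eq_mul] at h₁ h₂
  refine le_trans (Real.exp_le_exp.2 ?_) h₂
  have h₃ : (m : ℝ)⁻¹ * ∑ k, x k = ∑ T, subsetWeight x T * ((T.card : ℝ) / m) := by
    rw [← sum_subsetWeight_mul_card, Finset.mul_sum]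
    exact Finset.sum_congr rfl fun T _ => by ring
  rw [h₃]
  refine (mul_le_mul_of_nonneg_left h₁ hm'.le).trans_eq ?_
  rw [Finset.mul_sum]
  exact Finset.sum_congr rfl fun T _ => by ring

lemma sum_subsetWeight_const_mul_exp {m : ℕ} {p : ℝ} (hp : p ∈ Set.Ioo (0 : ℝ) 1) :
    ∑ T, subsetWeight (fun _ : Fin m => p) T * Real.exp (m * klBin ((T.card : ℝ) / m) p)
      = xi m := by
  have h : ∀ T : Finset (Fin m), subsetWeight (fun _ : Fin m => p) T
      * Real.exp (m * klBin ((T.card : ℝ) / m) p)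
      = (fun k : ℕ => (k / m : ℝ) ^ k * (1 - k / m : ℝ) ^ (m - k)) T.card := by
    intro T
    have hT : T.card ≤ m := card_finset_fin_le T
    dsimp only
    rw [← exp_mul_klBin_div hT hp, subsetWeight, Finset.prod_ite]
    congr 1
    simp only [Finset.prod_const]
    congr 2
    · congr 1; ext; simp
    · rw [show (Finset.univ.filter fun k => k ∉ T) = Tᶜ by ext; simp, Finset.card_compl,
        Fintype.card_fin]
  rw [Finset.sum_congr rfl fun T _ => h T, ← Finset.powerset_univ,
    Finset.sum_powerset_apply_card (fun k : ℕ => (k / m : ℝ) ^ k * (1 - k / m : ℝ) ^ (m - k)), xi]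
  simp [mul_assoc]

end MultilinearInterpolation

section ChangeOfMeasure

lemma integrable_of_measurable_of_abs_le {α : Type*} [MeasurableSpace α] {μ : Measure α}
    [IsFiniteMeasure μ] {f : α → ℝ} (hf : Measurable f) {C : ℝ} (hC : ∀ a, |f a| ≤ C) :
    Integrable f μ :=
  .of_bound hf.aestronglyMeasurable C (ae_of_all _ hC)

lemma integrable_of_measurable_of_mem_Icc {α : Type*} [MeasurableSpace α] {μ : Measure α}
    [IsFiniteMeasure μ] {f : α → ℝ} (hf : Measurable f) (hf' : ∀ a, f a ∈ Set.Icc (0 : ℝ) 1) :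
    Integrable f μ :=
  integrable_of_measurable_of_abs_le hf (C := 1) fun a =>
    abs_le.2 ⟨by linarith [(hf' a).1], (hf' a).2⟩

lemma integrable_exp_of_abs_le {α : Type*} [MeasurableSpace α] {μ : Measure α}
    [IsFiniteMeasure μ] {f : α → ℝ} (hf : Measurable f) {C : ℝ} (hC : ∀ a, |f a| ≤ C) :
    Integrable (fun a => Real.exp (f a)) μ :=
  integrable_of_measurable_of_abs_le hf.exp (C := Real.exp C) fun a => by
    rw [Real.abs_exp]
    exact Real.exp_le_exp.2 (le_of_abs_le (hC a))

variable {ι : Type*} [MeasurableSpace ι] {Q P : Measure ι}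
  [IsProbabilityMeasure Q] [IsProbabilityMeasure P]

/-- The Donsker–Varadhan change-of-measure inequality for bounded functions. -/
lemma integral_le_integral_llr_add_log_integral_exp (hQP : Q ≪ P) (hint : Integrable (llr Q P) Q)
    {f : ι → ℝ} (hf : Measurable f) {C : ℝ} (hC : ∀ i, |f i| ≤ C) :
    ∫ i, f i ∂Q ≤ ∫ i, llr Q P i ∂Q + Real.log (∫ i, Real.exp (f i) ∂P) := by
  have hfQ : Integrable f Q := integrable_of_measurable_of_abs_le hf hC
  have hfP : Integrable (fun i => Real.exp (f i)) P := integrable_exp_of_abs_le hf hC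
  have := isProbabilityMeasure_tilted hfP
  have h := InformationTheory.integral_llr_add_sub_measure_univ_nonneg
    (hQP.trans (absolutelyContinuous_tilted hfP)) (integrable_llr_tilted_right hQP hfQ hint hfP)
  rw [integral_llr_tilted_right hQP hfQ hfP hint] at h
  simp only [probReal_univ] at h
  linarith

lemma integral_prod_le_two_mul_integral_llr_add_log (hQP : Q ≪ P)
    (hint : Integrable (llr Q P) Q) {f : ι × ι → ℝ} (hf : Measurable f) {C : ℝ}
    (hC : ∀ q, |f q| ≤ C) :
    ∫ q, f q ∂Q.prod Q
      ≤ 2 * ∫ i, llr Q P i ∂Q + Real.log (∫ q, Real.exp (f q) ∂P.prod P) := by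
  set K := ∫ i, llr Q P i ∂Q
  set h : ι → ℝ := fun i => ∫ j, f (i, j) ∂Q
  have hh : Measurable h := (hf.stronglyMeasurable.integral_prod_right' (ν := Q)).measurable
  have hhC : ∀ i, |h i| ≤ C := fun i => by
    simpa using norm_integral_le_of_norm_le_const (μ := Q) (f := fun j => f (i, j))
      (ae_of_all _ fun j => hC (i, j))
  have hexp : Integrable (fun q => Real.exp (f q)) (P.prod P) := integrable_exp_of_abs_le hf hC
  have hpos : 0 < ∫ q, Real.exp (f q) ∂P.prod P := integral_exp_pos hexp
  have hinner : ∀ i, Real.exp (h i) ≤ Real.exp K * ∫ j, Real.exp (f (i, j)) ∂P := by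
    intro i
    have hfi : Measurable fun j => f (i, j) := hf.comp measurable_prodMk_left
    have hpos' : 0 < ∫ j, Real.exp (f (i, j)) ∂P :=
      integral_exp_pos (integrable_exp_of_abs_le hfi fun j => hC (i, j))
    rw [← Real.exp_log hpos', ← Real.exp_add]
    exact Real.exp_le_exp.2
      (integral_le_integral_llr_add_log_integral_exp hQP hint hfi fun j => hC (i, j))
  have houter : ∫ i, Real.exp (h i) ∂P ≤ Real.exp K * ∫ q, Real.exp (f q) ∂P.prod P := by
    rw [integral_prod _ hexp, ← integral_const_mul]
    exact integral_mono (integrable_exp_of_abs_le hh hhC) (hexp.integral_prod_left.const_mul _)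
      hinner
  have hlog : Real.log (∫ i, Real.exp (h i) ∂P)
      ≤ K + Real.log (∫ q, Real.exp (f q) ∂P.prod P) := by
    refine (Real.log_le_log (integral_exp_pos (integrable_exp_of_abs_le hh hhC)) houter).trans_eq ?_
    rw [Real.log_mul (Real.exp_ne_zero _) hpos.ne', Real.log_exp]
  have hmain := integral_le_integral_llr_add_log_integral_exp hQP hint hh hhC
  rw [integral_prod _ (integrable_of_measurable_of_abs_le hf hC)]
  linarith

end ChangeOfMeasure

section Concentration

variable {Ω : Type*} [MeasurableSpace Ω] {D : Measure Ω} [IsProbabilityMeasure D] {m : ℕ}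

lemma ae_pi_forall_of_ae {p : Ω → Prop} (h : ∀ᵐ ω ∂D, p ω) :
    ∀ᵐ S ∂Measure.pi fun _ : Fin m => D, ∀ k, p (S k) :=
  ae_all_iff.2 fun k => (Measure.quasiMeasurePreserving_eval (fun _ => D) k).ae h

lemma inv_mul_sum_mem_Icc {x : Fin m → ℝ} (hx : ∀ k, x k ∈ Set.Icc (0 : ℝ) 1) :
    (m : ℝ)⁻¹ * ∑ k, x k ∈ Set.Icc (0 : ℝ) 1 := by
  refine ⟨mul_nonneg (by positivity) (Finset.sum_nonneg fun k _ => (hx k).1), ?_⟩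
  have h : ∑ k, x k ≤ m := by
    simpa using Finset.sum_le_sum fun k (_ : k ∈ Finset.univ) => (hx k).2
  rw [inv_mul_eq_div]
  exact div_le_one_of_le₀ h (by positivity)

lemma integral_mem_Icc_of_forall {Z : Ω → ℝ} (hZ : Measurable Z)
    (hZ' : ∀ ω, Z ω ∈ Set.Icc (0 : ℝ) 1) : ∫ ω, Z ω ∂D ∈ Set.Icc (0 : ℝ) 1 := by
  have hint : Integrable Z D := integrable_of_measurable_of_mem_Icc hZ hZ'
  refine ⟨integral_nonneg fun ω => (hZ' ω).1, ?_⟩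
  simpa using integral_mono hint (integrable_const 1) fun ω => (hZ' ω).2

lemma ae_mean_eq_of_integral_eq (hm : 0 < m) {Z : Ω → ℝ} (hZ : Measurable Z)
    (hZ' : ∀ ω, Z ω ∈ Set.Icc (0 : ℝ) 1) :
    ∀ᵐ S ∂Measure.pi fun _ : Fin m => D,
      (∫ ω, Z ω ∂D = 0 → (m : ℝ)⁻¹ * ∑ k, Z (S k) = 0) ∧
      (∫ ω, Z ω ∂D = 1 → (m : ℝ)⁻¹ * ∑ k, Z (S k) = 1) := by
  have hm' : (m : ℝ) ≠ 0 := by exact_mod_cast hm.ne'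
  have hint : Integrable Z D := integrable_of_measurable_of_mem_Icc hZ hZ'
  have h : ∀ᵐ ω ∂D, (∫ ω, Z ω ∂D = 0 → Z ω = 0) ∧ (∫ ω, Z ω ∂D = 1 → Z ω = 1) := by
    refine Filter.Eventually.and ?_ ?_
    · by_cases h0 : ∫ ω, Z ω ∂D = 0
      · filter_upwards [(integral_eq_zero_iff_of_nonneg (fun ω => (hZ' ω).1) hint).1 h0]
          with ω hω _ using hω
      · exact ae_of_all _ fun ω h => absurd h h0
    · by_cases h1 : ∫ ω, Z ω ∂D = 1
      · have h1' : ∫ ω, (1 - Z ω) ∂D = 0 := by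
          rw [integral_sub (integrable_const _) hint, h1]; simp
        filter_upwards [(integral_eq_zero_iff_of_nonneg (fun ω => sub_nonneg.2 (hZ' ω).2)
          ((integrable_const _).sub hint)).1 h1'] with ω hω _
        exact (sub_eq_zero.1 hω).symm
      · exact ae_of_all _ fun ω h => absurd h h1
  filter_upwards [ae_pi_forall_of_ae h] with S hS
  refine ⟨fun h0 => ?_, fun h1 => ?_⟩
  · simp [fun k => (hS k).1 h0]
  · simp [fun k => (hS k).2 h1, hm']

/-- Maurer's bound on the exponential moment of the divergence between the empirical mean
and the mean of a `[0,1]`-valued variable. -/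
lemma lintegral_exp_mul_klBin_le_xi (hm : 0 < m) {Z : Ω → ℝ} (hZ : Measurable Z)
    (hZ' : ∀ ω, Z ω ∈ Set.Icc (0 : ℝ) 1) :
    ∫⁻ S, ENNReal.ofReal (Real.exp (m * klBin ((m : ℝ)⁻¹ * ∑ k, Z (S k)) (∫ ω, Z ω ∂D)))
      ∂(Measure.pi fun _ : Fin m => D) ≤ ENNReal.ofReal (xi m) := by
  have hint : Integrable Z D := integrable_of_measurable_of_mem_Icc hZ hZ'
  set p := ∫ ω, Z ω ∂D with hpdef
  have hp : p ∈ Set.Icc (0 : ℝ) 1 := integral_mem_Icc_of_forall hZ hZ'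
  by_cases hp01 : p = 0 ∨ p = 1
  · calc _ ≤ ∫⁻ _, 1 ∂(Measure.pi fun _ : Fin m => D) := by
          refine lintegral_mono_ae ?_
          filter_upwards [ae_mean_eq_of_integral_eq (D := D) hm hZ hZ'] with S hS
          rcases hp01 with h | h
          · rw [hS.1 h, h]; simp [klBin]
          · rw [hS.2 h, h]; simp [klBin]
      _ ≤ ENNReal.ofReal (xi m) := by
          simpa using one_le_xi m
  push Not at hp01
  have hp' : p ∈ Set.Ioo (0 : ℝ) 1 :=
    ⟨hp.1.lt_of_ne' hp01.1, hp.2.lt_of_ne hp01.2⟩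
  have hW : ∀ T : Finset (Fin m), Measurable fun S : Fin m → Ω =>
      subsetWeight (fun k => Z (S k)) T := by
    intro T
    refine Finset.measurable_prod _ fun k _ => ?_
    split_ifs <;> fun_prop
  have hWint : ∀ T : Finset (Fin m), Integrable (fun S : Fin m → Ω =>
      subsetWeight (fun k => Z (S k)) T) (Measure.pi fun _ : Fin m => D) := by
    intro T
    refine integrable_of_measurable_of_abs_le (hW T) (C := 1) fun S => ?_
    rw [abs_of_nonneg (subsetWeight_nonneg (fun k => hZ' _) T),
      ← sum_subsetWeight fun k => Z (S k)]
    exact Finset.single_le_sum (f := subsetWeight fun k => Z (S k))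
      (fun T _ => subsetWeight_nonneg (fun k => hZ' _) T) (Finset.mem_univ T)
  have hWval : ∀ T : Finset (Fin m), ∫ S, subsetWeight (fun k => Z (S k)) T
      ∂(Measure.pi fun _ : Fin m => D) = subsetWeight (fun _ => p) T := by
    intro T
    simp only [subsetWeight]
    rw [integral_fintype_prod_eq_prod (fun k ω => if k ∈ T then Z ω else 1 - Z ω)]
    refine Finset.prod_congr rfl fun k _ => ?_
    split_ifs
    · rfl
    · rw [integral_sub (integrable_const _) hint]; simp [hpdef]
  set c : Finset (Fin m) → ℝ := fun T => Real.exp (m * klBin ((T.card : ℝ) / m) p)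
  calc _ ≤ ∫⁻ S, ENNReal.ofReal (∑ T, subsetWeight (fun k => Z (S k)) T * c T)
        ∂(Measure.pi fun _ : Fin m => D) :=
        lintegral_mono fun S => ENNReal.ofReal_le_ofReal
          (exp_mul_klBin_mean_le hm hp' fun k => hZ' _)
    _ = ENNReal.ofReal (∫ S, ∑ T, subsetWeight (fun k => Z (S k)) T * c T
        ∂(Measure.pi fun _ : Fin m => D)) := by
        refine (ofReal_integral_eq_lintegral_ofReal
          (integrable_finsetSum _ fun T _ => (hWint T).mul_const _) (ae_of_all _ fun S => ?_)).symm
        exact Finset.sum_nonneg fun T _ =>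
          mul_nonneg (subsetWeight_nonneg (fun k => hZ' _) T) (Real.exp_nonneg _)
    _ = ENNReal.ofReal (xi m) := by
        rw [integral_finsetSum _ fun T _ => (hWint T).mul_const _]
        simp_rw [integral_mul_const, hWval]
        rw [sum_subsetWeight_const_mul_exp hp']

lemma abs_klTangent_le {r s q p : ℝ} (hr : 0 < r) (hs : 0 < s) (hq : q ∈ Set.Icc (0 : ℝ) 1)
    (hp : p ∈ Set.Icc (0 : ℝ) 1) :
    |klTangent r s q p| ≤ |Real.log r| + |Real.log s| + r + s + 1 := by
  have h₁ : |q * Real.log r| ≤ |Real.log r| := by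
    rw [abs_mul, abs_of_nonneg hq.1]
    exact mul_le_of_le_one_left (abs_nonneg _) hq.2
  have h₂ : |(1 - q) * Real.log s| ≤ |Real.log s| := by
    rw [abs_mul, abs_of_nonneg (sub_nonneg.2 hq.2)]
    exact mul_le_of_le_one_left (abs_nonneg _) (by linarith [hq.1])
  have h₃ : 0 ≤ p * r := mul_nonneg hp.1 hr.le
  have h₄ : p * r ≤ r := mul_le_of_le_one_left hr.le hp.2
  have h₅ : 0 ≤ (1 - p) * s := mul_nonneg (sub_nonneg.2 hp.2) hs.le
  have h₆ : (1 - p) * s ≤ s := mul_le_of_le_one_left hs.le (by linarith [hp.1])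
  rw [abs_le] at h₁ h₂ ⊢
  unfold klTangent
  constructor <;> linarith [h₁.1, h₁.2, h₂.1, h₂.2]

lemma ofReal_one_sub_le_measure_integral_exp_klTangent_le {J : Type*} [MeasurableSpace J]
    (π : Measure J) [IsProbabilityMeasure π] (hm : 0 < m) {δ : ℝ} (hδ : 0 < δ)
    {Z : J → Ω → ℝ} (hZ : Measurable fun q : J × Ω => Z q.1 q.2)
    (hZ' : ∀ j ω, Z j ω ∈ Set.Icc (0 : ℝ) 1) :
    ENNReal.ofReal (1 - δ) ≤ (Measure.pi fun _ : Fin m => D)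
      {S | ∀ r s, 0 < r → 0 < s →
        ∫ j, Real.exp (m * klTangent r s ((m : ℝ)⁻¹ * ∑ k, Z j (S k)) (∫ ω, Z j ω ∂D)) ∂π
          ≤ xi m / δ} := by
  have hm' : (0 : ℝ) < m := by exact_mod_cast hm
  have hxi : 0 < xi m := one_pos.trans_le (one_le_xi m)
  have hZj : ∀ j, Measurable (Z j) := fun j => hZ.comp measurable_prodMk_left
  have hp : Measurable fun j => ∫ ω, Z j ω ∂D :=
    (hZ.stronglyMeasurable.integral_prod_right' (ν := D)).measurable
  have hA : Measurable fun x : (Fin m → Ω) × J => (m : ℝ)⁻¹ * ∑ k, Z x.2 (x.1 k) :=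
    (Finset.measurable_sum _ fun k _ => hZ.comp
      (measurable_snd.prodMk ((measurable_pi_apply k).comp measurable_fst))).const_mul _
  have hp₂ : Measurable fun x : (Fin m → Ω) × J => ∫ ω, Z x.2 ω ∂D := hp.comp measurable_snd
  have hg : Measurable fun x : (Fin m → Ω) × J => ENNReal.ofReal (Real.exp
      (m * klBin ((m : ℝ)⁻¹ * ∑ k, Z x.2 (x.1 k)) (∫ ω, Z x.2 ω ∂D))) := by
    unfold klBin
    fun_prop
  set M : (Fin m → Ω) → ENNReal := fun S => ∫⁻ j, ENNReal.ofReal (Real.exp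
      (m * klBin ((m : ℝ)⁻¹ * ∑ k, Z j (S k)) (∫ ω, Z j ω ∂D))) ∂π
  have hM : Measurable M := hg.lintegral_prod_right'
  have hMle : ∫⁻ S, M S ∂(Measure.pi fun _ : Fin m => D) ≤ ENNReal.ofReal (xi m) := by
    rw [lintegral_lintegral_swap hg.aemeasurable]
    calc _ ≤ ∫⁻ _, ENNReal.ofReal (xi m) ∂π :=
          lintegral_mono fun j => lintegral_exp_mul_klBin_le_xi hm (hZj j) (hZ' j)
      _ = ENNReal.ofReal (xi m) := by simp
  have hmarkov : (Measure.pi fun _ : Fin m => D) {S | ENNReal.ofReal (xi m / δ) ≤ M S}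
      ≤ ENNReal.ofReal δ := by
    have hpos : 0 < xi m / δ := by positivity
    refine (meas_ge_le_lintegral_div hM.aemeasurable (ENNReal.ofReal_pos.2 hpos).ne'
      ENNReal.ofReal_ne_top).trans ?_
    refine (ENNReal.div_le_div_right hMle _).trans_eq ?_
    rw [← ENNReal.ofReal_div_of_pos hpos, div_div_cancel₀ hxi.ne']
  have hgood : ENNReal.ofReal (1 - δ) ≤
      (Measure.pi fun _ : Fin m => D) {S | ENNReal.ofReal (xi m / δ) ≤ M S}ᶜ := by
    rw [prob_compl_eq_one_sub (measurableSet_le measurable_const hM),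
      ENNReal.ofReal_sub _ hδ.le, ENNReal.ofReal_one]
    exact tsub_le_tsub_left hmarkov 1
  refine hgood.trans (measure_mono_ae ?_)
  have hae : ∀ᵐ S ∂Measure.pi fun _ : Fin m => D, ∀ᵐ j ∂π,
      (∫ ω, Z j ω ∂D = 0 → (m : ℝ)⁻¹ * ∑ k, Z j (S k) = 0) ∧
      (∫ ω, Z j ω ∂D = 1 → (m : ℝ)⁻¹ * ∑ k, Z j (S k) = 1) := by
    refine (Measure.ae_ae_comm ?_).2
      (ae_of_all _ fun j => ae_mean_eq_of_integral_eq hm (hZj j) (hZ' j))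
    have hset : ∀ a : ℝ, MeasurableSet {x : (Fin m → Ω) × J |
        ∫ ω, Z x.2 ω ∂D = a → (m : ℝ)⁻¹ * ∑ k, Z x.2 (x.1 k) = a} := fun a =>
      (measurableSet_eq_fun hp₂ measurable_const).himp (measurableSet_eq_fun hA measurable_const)
    exact (hset 0).inter (hset 1)
  filter_upwards [hae] with S hS hSgood r s hr hs
  have hSgood : M S < ENNReal.ofReal (xi m / δ) := not_le.1 hSgood
  have hAS : Measurable fun j => (m : ℝ)⁻¹ * ∑ k, Z j (S k) := hA.comp measurable_prodMk_left
  have hL : Measurable fun j =>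
      m * klTangent r s ((m : ℝ)⁻¹ * ∑ k, Z j (S k)) (∫ ω, Z j ω ∂D) := by
    unfold klTangent
    fun_prop
  have hLint : Integrable (fun j => Real.exp
      (m * klTangent r s ((m : ℝ)⁻¹ * ∑ k, Z j (S k)) (∫ ω, Z j ω ∂D))) π := by
    refine integrable_exp_of_abs_le hL
      (C := m * (|Real.log r| + |Real.log s| + r + s + 1)) fun j => ?_
    rw [abs_mul, abs_of_pos hm']
    exact mul_le_mul_of_nonneg_left (abs_klTangent_le hr hs
      (inv_mul_sum_mem_Icc fun k => hZ' _ _) (integral_mem_Icc_of_forall (hZj j) (hZ' j))) hm'.le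
  rw [← ENNReal.ofReal_le_ofReal_iff (by positivity),
    ofReal_integral_eq_lintegral_ofReal hLint (ae_of_all _ fun j => Real.exp_nonneg _)]
  refine (lintegral_mono_ae ?_).trans hSgood.le
  filter_upwards [hS] with j hj
  refine ENNReal.ofReal_le_ofReal (Real.exp_le_exp.2 (mul_le_mul_of_nonneg_left ?_ hm'.le))
  exact klTangent_le_klBin hr hs (inv_mul_sum_mem_Icc fun k => hZ' _ _)
    (integral_mem_Icc_of_forall (hZj j) (hZ' j)) hj.1 hj.2

end Concentration

section PairedLoss

lemma pairedLoss_mem_Icc {ℓ : ℝ → ℝ → ℝ → ℝ}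
    (hℓ : ℓ = pairedLossD ∨ ℓ = pairedLossE ∨ ℓ = pairedLossS) {a b y : ℝ}
    (ha : a ∈ Set.Icc (-1 : ℝ) 1) (hb : b ∈ Set.Icc (-1 : ℝ) 1) (hy : y = 1 ∨ y = -1) :
    ℓ a b y ∈ Set.Icc (0 : ℝ) 1 := by
  obtain ⟨ha₁, ha₂⟩ := ha
  obtain ⟨hb₁, hb₂⟩ := hb
  rcases hℓ with rfl | rfl | rfl
  · constructor <;> simp only [pairedLossD] <;> nlinarith
  all_goals
    rcases hy with rfl | rfl <;> constructor <;> simp only [pairedLossE, pairedLossS] <;> nlinarith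

lemma measurable_pairedLoss {ℓ : ℝ → ℝ → ℝ → ℝ}
    (hℓ : ℓ = pairedLossD ∨ ℓ = pairedLossE ∨ ℓ = pairedLossS) :
    Measurable fun t : ℝ × ℝ × ℝ => ℓ t.1 t.2.1 t.2.2 := by
  rcases hℓ with rfl | rfl | rfl
  · unfold pairedLossD; fun_prop
  · unfold pairedLossE; fun_prop
  · unfold pairedLossS; fun_prop

end PairedLoss

lemma klBin_integral_le_of_integral_exp_klTangent_le {ι : Type*} [MeasurableSpace ι]
    {Q P : Measure ι} [IsProbabilityMeasure Q] [IsProbabilityMeasure P] (hQP : Q ≪ P)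
    (hint : Integrable (llr Q P) Q) {m : ℕ} (hm : 0 < m) {B : ℝ} {A p : ι × ι → ℝ}
    (hA : Measurable A) (hA' : ∀ q, A q ∈ Set.Icc (0 : ℝ) 1)
    (hp : Measurable p) (hp' : ∀ q, p q ∈ Set.Icc (0 : ℝ) 1)
    (h : ∀ r s, 0 < r → 0 < s →
      ∫ q, Real.exp (m * klTangent r s (A q) (p q)) ∂P.prod P ≤ B) :
    klBin (∫ q, A q ∂Q.prod Q) (∫ q, p q ∂Q.prod Q)
      ≤ (m : ℝ)⁻¹ * (2 * ∫ i, llr Q P i ∂Q + Real.log B) := by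
  have hm' : (0 : ℝ) < m := by exact_mod_cast hm
  have hAint : Integrable A (Q.prod Q) := integrable_of_measurable_of_mem_Icc hA hA'
  have hpint : Integrable p (Q.prod Q) := integrable_of_measurable_of_mem_Icc hp hp'
  refine klBin_le_of_forall_klTangent_le (integral_mem_Icc_of_forall hA hA')
    (integral_mem_Icc_of_forall hp hp') fun r s hr hs => ?_
  have hL : Measurable fun q => m * klTangent r s (A q) (p q) := by
    unfold klTangent
    fun_prop
  have hLC : ∀ q, |m * klTangent r s (A q) (p q)|
      ≤ m * (|Real.log r| + |Real.log s| + r + s + 1) := fun q => by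
    rw [abs_mul, abs_of_pos hm']
    exact mul_le_mul_of_nonneg_left (abs_klTangent_le hr hs (hA' q) (hp' q)) hm'.le
  have hlin : ∫ q, m * klTangent r s (A q) (p q) ∂Q.prod Q
      = m * klTangent r s (∫ q, A q ∂Q.prod Q) (∫ q, p q ∂Q.prod Q) := by
    have haffine : ∀ a b, klTangent r s a b
        = a * (Real.log r - Real.log s) + b * (s - r) + (Real.log s + 1 - s) := fun a b => by
      unfold klTangent
      ring
    simp_rw [haffine]
    rw [integral_const_mul,
      integral_add (f := fun q => A q * (Real.log r - Real.log s) + p q * (s - r))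
        ((hAint.mul_const _).add (hpint.mul_const _)) (integrable_const _),
      integral_add (hAint.mul_const _) (hpint.mul_const _),
      integral_mul_const, integral_mul_const]
    simp
  have hDV := integral_prod_le_two_mul_integral_llr_add_log hQP hint hL hLC
  have hlog := Real.log_le_log (integral_exp_pos (integrable_exp_of_abs_le hL hLC)) (h r s hr hs)
  rw [hlin] at hDV
  rw [inv_mul_eq_div, le_div_iff₀ hm']
  linarith

/-- PAC-Bayesian theorem for `d_Q`, `e_Q` or `s_Q`: with `α` being any one of the
expected disagreement, joint error or joint success, with probability at least `1 - δ`
over `S ∼ D^m`, simultaneously for all posteriors `Q`,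
`kl(α_Q^S ‖ α_Q^D) ≤ (1/m)·[2·KL(Q‖P) + ln(ξ(m)/δ)]`. -/
theorem statement12 {X ι : Type*} [MeasurableSpace X] [MeasurableSpace ι]
    (D : Measure (X × ℝ)) [IsProbabilityMeasure D]
    (hY : ∀ᵐ p ∂D, p.2 = 1 ∨ p.2 = -1)
    (F : ι → X → ℝ) (hF : ∀ i x, F i x ∈ Set.Icc (-1 : ℝ) 1)
    (hFmeas : Measurable fun q : ι × X => F q.1 q.2)
    (P : Measure ι) [IsProbabilityMeasure P]
    (δ : ℝ) (hδ : δ ∈ Set.Ioc (0 : ℝ) 1)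
    (m : ℕ) (hm : 0 < m)
    (ℓ : ℝ → ℝ → ℝ → ℝ)
    (hℓ : ℓ = pairedLossD ∨ ℓ = pairedLossE ∨ ℓ = pairedLossS) :
    ENNReal.ofReal (1 - δ) ≤
      (Measure.pi fun _ : Fin m => D)
        {S | ∀ Q : Measure ι, IsProbabilityMeasure Q →
          ((klBin
              ((m : ℝ)⁻¹ * ∑ k, ∫ i, ∫ j, ℓ (F i (S k).1) (F j (S k).1) (S k).2 ∂Q ∂Q)
              (∫ p, ∫ i, ∫ j, ℓ (F i p.1) (F j p.1) p.2 ∂Q ∂Q ∂D) : ℝ) : EReal) ≤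
            (((m : ℝ)⁻¹ : ℝ) : EReal) *
              (((2 : ℝ) : EReal) * klDivE Q P
                + ((Real.log (xi m / δ) : ℝ) : EReal))} := by
  classical
  set Z : ι × ι → X × ℝ → ℝ := fun q p =>
    if p.2 = 1 ∨ p.2 = -1 then ℓ (F q.1 p.1) (F q.2 p.1) p.2 else 0 with hZdef
  have hZ' : ∀ q p, Z q p ∈ Set.Icc (0 : ℝ) 1 := by
    intro q p
    simp only [hZdef]
    split_ifs with hp
    · exact pairedLoss_mem_Icc hℓ (hF _ _) (hF _ _) hp
    · exact ⟨le_rfl, zero_le_one⟩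
  have hZ : Measurable fun t : (ι × ι) × (X × ℝ) => Z t.1 t.2 := by
    refine Measurable.ite ?_ ?_ measurable_const
    · exact (measurableSet_eq_fun (by fun_prop) measurable_const).union
        (measurableSet_eq_fun (by fun_prop) measurable_const)
    · exact (measurable_pairedLoss hℓ).comp
        ((hFmeas.comp ((measurable_fst.comp measurable_fst).prodMk
          (measurable_fst.comp measurable_snd))).prodMk
        ((hFmeas.comp ((measurable_snd.comp measurable_fst).prodMk
          (measurable_fst.comp measurable_snd))).prodMk (measurable_snd.comp measurable_snd)))
  refine (ofReal_one_sub_le_measure_integral_exp_klTangent_le (D := D) (P.prod P) hm hδ.1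
    hZ hZ').trans (measure_mono_ae ?_)
  filter_upwards [ae_pi_forall_of_ae hY] with S hSy hS Q hQ
  have hm' : (0 : ℝ) < m := by exact_mod_cast hm
  by_cases hac : Q ≪ P ∧ Integrable (fun i => Real.log ((Q.rnDeriv P) i).toReal) Q
  swap
  · rw [klDivE, if_neg hac, EReal.coe_mul_top_of_pos two_pos, EReal.top_add_coe,
      EReal.coe_mul_top_of_pos (inv_pos.2 hm')]
    exact le_top
  rw [klDivE, if_pos hac]
  norm_cast
  have hZint : ∀ p, Integrable (fun q => Z q p) (Q.prod Q) := fun p =>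
    integrable_of_measurable_of_mem_Icc (hZ.comp measurable_prodMk_right) fun q => hZ' q p
  have hpair : ∀ p : X × ℝ, p.2 = 1 ∨ p.2 = -1 →
      ∫ i, ∫ j, ℓ (F i p.1) (F j p.1) p.2 ∂Q ∂Q = ∫ q, Z q p ∂Q.prod Q := by
    intro p hp
    rw [integral_prod _ (hZint p)]
    simp only [hZdef, if_pos hp]
  have hemp : (m : ℝ)⁻¹ * ∑ k, ∫ i, ∫ j, ℓ (F i (S k).1) (F j (S k).1) (S k).2 ∂Q ∂Q
      = ∫ q, (m : ℝ)⁻¹ * ∑ k, Z q (S k) ∂Q.prod Q := by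
    rw [integral_const_mul, integral_finsetSum _ fun k _ => hZint (S k)]
    exact congrArg _ (Finset.sum_congr rfl fun k _ => hpair _ (hSy k))
  have hexp : ∫ p, ∫ i, ∫ j, ℓ (F i p.1) (F j p.1) p.2 ∂Q ∂Q ∂D
      = ∫ q, ∫ p, Z q p ∂D ∂Q.prod Q := by
    rw [integral_congr_ae (hY.mono hpair), integral_integral_swap]
    exact integrable_of_measurable_of_mem_Icc (hZ.comp measurable_swap) fun t => hZ' t.2 t.1
  rw [hemp, hexp]
  exact klBin_integral_le_of_integral_exp_klTangent_le hac.1 hac.2 hm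
    ((Finset.measurable_sum _ fun k _ => hZ.comp measurable_prodMk_right).const_mul _)
    (fun q => inv_mul_sum_mem_Icc fun k => hZ' _ _)
    (hZ.stronglyMeasurable.integral_prod_right' (ν := D)).measurable
    (fun q => integral_mem_Icc_of_forall (hZ.comp measurable_prodMk_left) (hZ' q)) hS
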